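/- In the overlap array setup, suppose μ satisfies the Ghirlanda–Guerra identities for both system 1 and system 2, μ is a.s. positive semidefinite, and μ( R_{l,l'} = R_{1,1} for all l, l' ≥ 1 ) = 1. Let μ₁ be the law of |R¹_{1,2}| and μ₂ the law of |R²_{1,2}| under μ, and let c₁ = inf supp μ₁ and c₂ = inf supp μ₂. Then μ( |R_{1,1}| > √(c₁ c₂) ) = 0. -/

import Mathlib

open MeasureTheory

namespace OverlapArray

/-- The space `([-1,1]^{ℕ×ℕ})³` of triples of overlap arrays
`((R¹_{l,l'}), (R²_{l,l'}), (R_{l,l'}))` (realized inside `(ℝ^{ℕ×ℕ})³`, the constraint that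
entries lie in `[-1,1]` being imposed almost surely). -/
abbrev OA : Type := (ℕ → ℕ → ℝ) × (ℕ → ℕ → ℝ) × (ℕ → ℕ → ℝ)

/-- The overlap array `(R¹_{l,l'})` of the first system. -/
def R1 (ω : OA) : ℕ → ℕ → ℝ := ω.1

/-- The overlap array `(R²_{l,l'})` of the second system. -/
def R2 (ω : OA) : ℕ → ℕ → ℝ := ω.2.1

/-- The array `(R_{l,l'})` of cross overlaps. -/
def R (ω : OA) : ℕ → ℕ → ℝ := ω.2.2

/-- Relabelling the replicas of the first system by `π` and of the second system by `π'`. -/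
def permMap (π π' : Equiv.Perm ℕ) (ω : OA) : OA :=
  (fun l l' => R1 ω (π l) (π l'), fun l l' => R2 ω (π' l) (π' l'),
   fun l l' => R ω (π l) (π' l'))

/-- The overlap array setup: `μ` is a probability measure on `OA` with entries a.s. in
`[-1,1]`, `R¹, R²` a.s. symmetric with unit diagonal, and `μ` invariant under finitely
supported permutations of the replicas of each system. -/
structure Setup (μ : Measure OA) : Prop where
  prob : IsProbabilityMeasure μ
  bounded : ∀ᵐ ω ∂μ, ∀ l l', |R1 ω l l'| ≤ 1 ∧ |R2 ω l l'| ≤ 1 ∧ |R ω l l'| ≤ 1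
  symm : ∀ᵐ ω ∂μ, ∀ l l', R1 ω l l' = R1 ω l' l ∧ R2 ω l l' = R2 ω l' l
  diag : ∀ᵐ ω ∂μ, ∀ l, R1 ω l l = 1 ∧ R2 ω l l = 1
  exch : ∀ π π' : Equiv.Perm ℕ, {x | π x ≠ x}.Finite → {x | π' x ≠ x}.Finite →
    μ.map (permMap π π') = μ

/-- Evaluation of a function `f` of the overlaps on the first `n` replicas. -/
def fRep (n : ℕ)
    (f : ((Fin n → Fin n → ℝ) × (Fin n → Fin n → ℝ) × (Fin n → Fin n → ℝ)) → ℝ)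
    (ω : OA) : ℝ :=
  f (fun l l' => R1 ω l.val l'.val, fun l l' => R2 ω l.val l'.val,
     fun l l' => R ω l.val l'.val)

/-- The Ghirlanda–Guerra identities for system 1: for every `n ≥ 1`, every bounded
measurable function `f` of the overlaps on `n` replicas and every bounded Borel even
`ψ : [-1,1] → ℝ`,
`E[f·ψ(R¹_{1,n+1})] = (1/n) E[f]·E[ψ(R¹_{1,2})] + (1/n) ∑_{l=2}^n E[f·ψ(R¹_{1,l})]`
(replicas are indexed from `0` here, so `R¹_{1,l}` is `R1 ω 0 (l-1)`). -/
def GG1 (μ : Measure OA) : Prop :=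
  ∀ n : ℕ, 1 ≤ n →
  ∀ f : ((Fin n → Fin n → ℝ) × (Fin n → Fin n → ℝ) × (Fin n → Fin n → ℝ)) → ℝ,
    Measurable f → (∃ C, ∀ v, |f v| ≤ C) →
  ∀ ψ : ℝ → ℝ, Measurable ψ → (∃ C, ∀ x, |ψ x| ≤ C) → (∀ x, ψ (-x) = ψ x) →
    ∫ ω, fRep n f ω * ψ (R1 ω 0 n) ∂μ
      = (1 / n) * (∫ ω, fRep n f ω ∂μ) * (∫ ω, ψ (R1 ω 0 1) ∂μ)
        + (1 / n) * ∑ l ∈ Finset.Ico 1 n, ∫ ω, fRep n f ω * ψ (R1 ω 0 l) ∂μ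

/-- The Ghirlanda–Guerra identities for system 2. -/
def GG2 (μ : Measure OA) : Prop :=
  ∀ n : ℕ, 1 ≤ n →
  ∀ f : ((Fin n → Fin n → ℝ) × (Fin n → Fin n → ℝ) × (Fin n → Fin n → ℝ)) → ℝ,
    Measurable f → (∃ C, ∀ v, |f v| ≤ C) →
  ∀ ψ : ℝ → ℝ, Measurable ψ → (∃ C, ∀ x, |ψ x| ≤ C) → (∀ x, ψ (-x) = ψ x) →
    ∫ ω, fRep n f ω * ψ (R2 ω 0 n) ∂μ
      = (1 / n) * (∫ ω, fRep n f ω ∂μ) * (∫ ω, ψ (R2 ω 0 1) ∂μ)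
        + (1 / n) * ∑ l ∈ Finset.Ico 1 n, ∫ ω, fRep n f ω * ψ (R2 ω 0 l) ∂μ

/-- The event `{R_{1,1} ∈ A}`. -/
def EA (A : Set ℝ) : Set OA := {ω | R ω 0 0 ∈ A}

/-- The event `{|R¹_{l,l'}| ∈ A₁ for all l ≠ l' ≤ n}` (with `0`-based replica indices). -/
def E1 (n : ℕ) (A1 : Set ℝ) : Set OA :=
  {ω | ∀ l l', l < n → l' < n → l ≠ l' → |R1 ω l l'| ∈ A1}

/-- The event `{|R²_{l,l'}| ∈ A₂ for all l ≠ l' ≤ n}` (with `0`-based replica indices). -/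
def E2 (n : ℕ) (A2 : Set ℝ) : Set OA :=
  {ω | ∀ l l', l < n → l' < n → l ≠ l' → |R2 ω l l'| ∈ A2}

/-- The event `B_n`. -/
def Bev (n : ℕ) (A A1 A2 : Set ℝ) : Set OA := EA A ∩ E1 n A1 ∩ E2 n A2

/-- The event `C_n`. -/
def Cev (n : ℕ) (A A1 A2 : Set ℝ) : Set OA := EA A ∩ E1 (n + 1) A1 ∩ E2 n A2

end OverlapArray

namespace OverlapArray

/-- The joint `2n×2n` overlap matrix of `n` replicas of each system: blocks `R¹`, `R`, `Rᵀ`,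
`R²`. -/
def ovMatrix (ω : OA) (n : ℕ) : Matrix (Fin n ⊕ Fin n) (Fin n ⊕ Fin n) ℝ :=
  fun i j =>
    match i, j with
    | Sum.inl l, Sum.inl l' => R1 ω l.val l'.val
    | Sum.inl l, Sum.inr l' => R ω l.val l'.val
    | Sum.inr l, Sum.inl l' => R ω l'.val l.val
    | Sum.inr l, Sum.inr l' => R2 ω l.val l'.val

/-- `μ` is a.s. positive semidefinite: almost surely all the joint overlap matrices are
positive semidefinite. -/
def PSDas (μ : MeasureTheory.Measure OA) : Prop :=
  ∀ᵐ ω ∂μ, ∀ n : ℕ, 1 ≤ n → (ovMatrix ω n).PosSemidef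

/-- The support of the law `μ₁` of `|R¹_{1,2}|` under `μ`: the set of points all of whose
open neighbourhoods have positive measure (i.e. the smallest closed set of full measure). -/
def supp1 (μ : MeasureTheory.Measure OA) : Set ℝ :=
  {x | ∀ U : Set ℝ, IsOpen U → x ∈ U → 0 < μ {ω | |R1 ω 0 1| ∈ U}}

/-- The support of the law `μ₂` of `|R²_{1,2}|` under `μ`. -/
def supp2 (μ : MeasureTheory.Measure OA) : Set ℝ :=
  {x | ∀ U : Set ℝ, IsOpen U → x ∈ U → 0 < μ {ω | |R2 ω 0 1| ∈ U}}

end OverlapArray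

open OverlapArray

namespace OverlapArray

/-- The event that all off-diagonal entries among the first `n` replicas lie in `A`. -/
def goodX (X : OA → ℕ → ℕ → ℝ) (A : Set ℝ) (n : ℕ) : Set OA :=
  {ω | ∀ l l', l < n → l' < n → l ≠ l' → |X ω l l'| ∈ A}

/-- The event that the `(i,j)` entry is not in `A`. -/
def badX (X : OA → ℕ → ℕ → ℝ) (A : Set ℝ) (i j : ℕ) : Set OA :=
  {ω | |X ω i j| ∉ A}

lemma measurable_R1 (l l' : ℕ) : Measurable (fun ω : OA => R1 ω l l') := by
  unfold R1; fun_prop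

lemma measurable_R2 (l l' : ℕ) : Measurable (fun ω : OA => R2 ω l l') := by
  unfold R2; fun_prop

lemma measurable_R (l l' : ℕ) : Measurable (fun ω : OA => R ω l l') := by
  unfold R; fun_prop

lemma meas_good {X : OA → ℕ → ℕ → ℝ} (hX : ∀ l l', Measurable fun ω => X ω l l')
    {A : Set ℝ} (hA : MeasurableSet A) (n : ℕ) : MeasurableSet (goodX X A n) := by
  have : goodX X A n = ⋂ l, ⋂ l', ⋂ (_ : l < n), ⋂ (_ : l' < n), ⋂ (_ : l ≠ l'),
      (fun ω => |X ω l l'|) ⁻¹' A := by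
    ext ω; simp [goodX]
  rw [this]
  refine MeasurableSet.iInter fun l => MeasurableSet.iInter fun l' => MeasurableSet.iInter fun _ =>
    MeasurableSet.iInter fun _ => MeasurableSet.iInter fun _ => ?_
  exact (measurable_norm.comp (hX l l')) hA

lemma meas_bad {X : OA → ℕ → ℕ → ℝ} (hX : ∀ l l', Measurable fun ω => X ω l l')
    {A : Set ℝ} (hA : MeasurableSet A) (i j : ℕ) : MeasurableSet (badX X A i j) :=
  (measurable_norm.comp (hX i j)) hA.compl

lemma swap_fin (a b : ℕ) : {x | Equiv.swap a b x ≠ x}.Finite := by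
  refine (Set.toFinite {a, b}).subset ?_
  intro x hx
  by_contra h
  simp only [Set.mem_insert_iff, Set.mem_singleton_iff, not_or] at h
  exact hx (Equiv.swap_apply_of_ne_of_ne h.1 h.2)

lemma core (μ : Measure OA) [IsProbabilityMeasure μ] (X : OA → ℕ → ℕ → ℝ)
    (hX : ∀ l l', Measurable fun ω => X ω l l')
    (hsymm : ∀ᵐ ω ∂μ, ∀ l l', X ω l l' = X ω l' l) (A : Set ℝ) (hA : MeasurableSet A)
    (G : Set OA) (hG : MeasurableSet G) (M : ℕ)
    (hGG : ∀ n N : ℕ, 1 ≤ n → n ≤ N → M ≤ N →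
      N * μ.real (G ∩ goodX X A n ∩ badX X A 0 N) =
        μ.real (G ∩ goodX X A n) * μ.real (badX X A 0 1)
        + ∑ k ∈ Finset.Ico 1 N, μ.real (G ∩ goodX X A n ∩ badX X A 0 k))
    (hex : ∀ (n : ℕ) (π : Equiv.Perm ℕ), {x | π x ≠ x}.Finite → (∀ l, π l < n ↔ l < n) →
      ∀ i j, μ.real (G ∩ goodX X A n ∩ badX X A (π i) (π j))
        = μ.real (G ∩ goodX X A n ∩ badX X A i j))
    (hpos : 0 < μ.real G) (hp : μ.real (badX X A 0 1) < 1) :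
    ∀ n : ℕ, 1 ≤ n → 0 < μ.real (G ∩ goodX X A n) := by
  intro n hn
  induction n, hn using Nat.le_induction with
  | base =>
    have : goodX X A 1 = Set.univ := by
      ext ω
      simp only [goodX, Set.mem_ofPred_eq, Set.mem_univ, iff_true]
      intro l l' h1 h2 h3
      omega
    rwa [this, Set.inter_univ]
  | succ n hn ih =>
    set S := G ∩ goodX X A n with hS
    set q := μ.real (badX X A 0 1)
    have hSm : MeasurableSet S := hG.inter (meas_good hX hA n)
    set x := μ.real (S ∩ badX X A 0 n) with hx
    have hxk : ∀ k, n ≤ k → μ.real (S ∩ badX X A 0 k) = x := by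
      intro k hk
      have := hex n (Equiv.swap n k) (swap_fin n k) (by
        intro l
        rcases eq_or_ne l n with rfl | h1
        · simp; omega
        rcases eq_or_ne l k with rfl | h2
        · simp; omega
        rw [Equiv.swap_apply_of_ne_of_ne h1 h2]) 0 n
      rwa [Equiv.swap_apply_left, Equiv.swap_apply_of_ne_of_ne (by omega) (by omega)] at this
    have hxl : ∀ l, l < n → μ.real (S ∩ badX X A l n) = x := by
      intro l hl
      have := hex n (Equiv.swap 0 l) (swap_fin 0 l) (by
        intro k
        rcases eq_or_ne k 0 with rfl | h1
        · simp; omega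
        rcases eq_or_ne k l with rfl | h2
        · simp; omega
        rw [Equiv.swap_apply_of_ne_of_ne h1 h2]) 0 n
      rwa [Equiv.swap_apply_left, Equiv.swap_apply_of_ne_of_ne (by omega) (by omega)] at this
    have hx0 : ∀ k, 1 ≤ k → k < n → μ.real (S ∩ badX X A 0 k) = 0 := by
      intro k h1 h2
      have : S ∩ badX X A 0 k = ∅ := by
        ext ω
        simp only [Set.mem_inter_iff, Set.mem_empty_iff_false, iff_false, not_and]
        intro h h'
        exact h' (h.2 0 k (by omega) h2 (by omega))
      rw [this]; simp
    have hkey : (n : ℝ) * x = μ.real S * q := by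
      have h := hGG n (max n M) hn (le_max_left _ _) (le_max_right _ _)
      set N := max n M
      have hN : n ≤ N := le_max_left _ _
      rw [← hS, hxk N hN, ← Finset.sum_Ico_consecutive _ hn hN,
        Finset.sum_eq_zero (fun k hk => hx0 k (Finset.mem_Ico.1 hk).1 (Finset.mem_Ico.1 hk).2),
        Finset.sum_congr rfl (fun k hk => hxk k (Finset.mem_Ico.1 hk).1)] at h
      simp only [Finset.sum_const, Nat.card_Ico, nsmul_eq_mul, Nat.cast_sub hN] at h
      linarith
    have hsub : S ≤ᵐ[μ] ((G ∩ goodX X A (n + 1)) ∪ ⋃ l ∈ Finset.range n, S ∩ badX X A l n : Set OA) := by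
      filter_upwards [hsymm] with ω hω hωS
      by_cases hb : ∃ l, l < n ∧ |X ω l n| ∉ A
      · obtain ⟨l, hl, hlA⟩ := hb
        refine Or.inr ?_
        simp only [Set.mem_iUnion, Finset.mem_range]
        exact ⟨l, hl, hωS, hlA⟩
      · push Not at hb
        refine Or.inl ⟨hωS.1, ?_⟩
        intro l l' h1 h2 h3
        rcases Nat.lt_succ_iff_lt_or_eq.1 h1 with h1 | rfl
        · rcases Nat.lt_succ_iff_lt_or_eq.1 h2 with h2 | rfl
          · exact hωS.2 l l' h1 h2 h3
          · exact hb l h1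
        · rw [hω]
          exact hb l' (by omega)
    have h1 : μ.real S ≤ μ.real (G ∩ goodX X A (n + 1)) + ∑ l ∈ Finset.range n, μ.real (S ∩ badX X A l n) := by
      refine (ENNReal.toReal_mono (measure_ne_top _ _) (measure_mono_ae hsub)).trans ?_
      refine (measureReal_union_le _ _).trans ?_
      gcongr
      exact measureReal_biUnion_finset_le _ _
    rw [Finset.sum_congr rfl (fun l hl => hxl l (Finset.mem_range.1 hl))] at h1
    simp only [Finset.sum_const, Finset.card_range, nsmul_eq_mul] at h1
    rw [hkey] at h1
    nlinarith

/-- The joint event. -/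
def Sev (A A1 A2 : Set ℝ) (n m : ℕ) : Set OA := EA A ∩ goodX R1 A1 n ∩ goodX R2 A2 m

/-- The joint event as a subset of the finite arrays. -/
def Tev (A A1 A2 : Set ℝ) (n m N : ℕ) :
    Set ((Fin N → Fin N → ℝ) × (Fin N → Fin N → ℝ) × (Fin N → Fin N → ℝ)) :=
  {v | (∀ i : Fin N, i.val = 0 → v.2.2 i i ∈ A) ∧
    (∀ i j : Fin N, i.val < n → j.val < n → i ≠ j → |v.1 i j| ∈ A1) ∧
    (∀ i j : Fin N, i.val < m → j.val < m → i ≠ j → |v.2.1 i j| ∈ A2)}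

lemma meas_Tev {A A1 A2 : Set ℝ} (hA : MeasurableSet A) (hA1 : MeasurableSet A1)
    (hA2 : MeasurableSet A2) (n m N : ℕ) : MeasurableSet (Tev A A1 A2 n m N) := by
  have e : Tev A A1 A2 n m N = (⋂ i : Fin N, ⋂ (_ : i.val = 0), (fun v => v.2.2 i i) ⁻¹' A) ∩
      ((⋂ i : Fin N, ⋂ j : Fin N, ⋂ (_ : i.val < n), ⋂ (_ : j.val < n), ⋂ (_ : i ≠ j),
        (fun v => |v.1 i j|) ⁻¹' A1) ∩
      (⋂ i : Fin N, ⋂ j : Fin N, ⋂ (_ : i.val < m), ⋂ (_ : j.val < m), ⋂ (_ : i ≠ j),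
        (fun v => |v.2.1 i j|) ⁻¹' A2)) := by
    ext v
    simp [Tev]
  rw [e]
  refine MeasurableSet.inter ?_ (MeasurableSet.inter ?_ ?_)
  · refine MeasurableSet.iInter fun i => MeasurableSet.iInter fun _ => ?_
    exact (show Measurable fun v : (Fin N → Fin N → ℝ) × (Fin N → Fin N → ℝ) × (Fin N → Fin N → ℝ)
      => v.2.2 i i by fun_prop) hA
  · refine MeasurableSet.iInter fun i => MeasurableSet.iInter fun j => MeasurableSet.iInter fun _ =>
      MeasurableSet.iInter fun _ => MeasurableSet.iInter fun _ => ?_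
    exact (measurable_norm.comp (show Measurable fun v : (Fin N → Fin N → ℝ) ×
      (Fin N → Fin N → ℝ) × (Fin N → Fin N → ℝ) => v.1 i j by fun_prop)) hA1
  · refine MeasurableSet.iInter fun i => MeasurableSet.iInter fun j => MeasurableSet.iInter fun _ =>
      MeasurableSet.iInter fun _ => MeasurableSet.iInter fun _ => ?_
    exact (measurable_norm.comp (show Measurable fun v : (Fin N → Fin N → ℝ) ×
      (Fin N → Fin N → ℝ) × (Fin N → Fin N → ℝ) => v.2.1 i j by fun_prop)) hA2

lemma fRep_Tev (A A1 A2 : Set ℝ) {n m N : ℕ} (hN : 1 ≤ N) (hn : n ≤ N) (hm : m ≤ N) :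
    fRep N ((Tev A A1 A2 n m N).indicator 1) = (Sev A A1 A2 n m).indicator (1 : OA → ℝ) := by
  funext ω
  have : ((fun l l' => R1 ω l.val l'.val, fun l l' => R2 ω l.val l'.val,
     fun l l' => R ω l.val l'.val) : (Fin N → Fin N → ℝ) × (Fin N → Fin N → ℝ) ×
      (Fin N → Fin N → ℝ)) ∈ Tev A A1 A2 n m N ↔ ω ∈ Sev A A1 A2 n m := by
    constructor
    · rintro ⟨h0, h1, h2⟩
      refine ⟨⟨h0 ⟨0, hN⟩ rfl, ?_⟩, ?_⟩
      · intro l l' hl hl' hne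
        exact h1 ⟨l, by omega⟩ ⟨l', by omega⟩ hl hl' (by simpa using hne)
      · intro l l' hl hl' hne
        exact h2 ⟨l, by omega⟩ ⟨l', by omega⟩ hl hl' (by simpa using hne)
    · rintro ⟨⟨h0, h1⟩, h2⟩
      refine ⟨?_, ?_, ?_⟩
      · intro i hi
        simp only [hi]
        exact h0
      · intro i j hi hj hne
        exact h1 i j hi hj (fun h => hne (Fin.ext h))
      · intro i j hi hj hne
        exact h2 i j hi hj (fun h => hne (Fin.ext h))
  unfold fRep
  by_cases h : ω ∈ Sev A A1 A2 n m
  · rw [Set.indicator_of_mem h, Set.indicator_of_mem (this.2 h)]; rfl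
  · rw [Set.indicator_of_notMem h, Set.indicator_of_notMem (fun h' => h (this.1 h'))]

lemma meas_Sev {A A1 A2 : Set ℝ} (hA : MeasurableSet A) (hA1 : MeasurableSet A1)
    (hA2 : MeasurableSet A2) (n m : ℕ) : MeasurableSet (Sev A A1 A2 n m) :=
  (((measurable_R 0 0) hA).inter (meas_good measurable_R1 hA1 n)).inter
    (meas_good measurable_R2 hA2 m)

/-- The test function. -/
noncomputable def psi (A : Set ℝ) (x : ℝ) : ℝ := ({y : ℝ | |y| ∉ A}).indicator (fun _ => (1 : ℝ)) x

lemma psi_meas {A : Set ℝ} (hA : MeasurableSet A) : Measurable (psi A) :=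
  measurable_const.indicator (measurable_norm hA.compl)

lemma psi_bdd (A : Set ℝ) : ∃ C, ∀ x, |psi A x| ≤ C := by
  refine ⟨1, fun x => ?_⟩
  unfold psi
  by_cases h : x ∈ {y : ℝ | |y| ∉ A}
  · rw [Set.indicator_of_mem h]; simp
  · rw [Set.indicator_of_notMem h]; simp

lemma psi_even (A : Set ℝ) (x : ℝ) : psi A (-x) = psi A x := by
  have : -x ∈ {y : ℝ | |y| ∉ A} ↔ x ∈ {y : ℝ | |y| ∉ A} := by
    change |-x| ∉ A ↔ |x| ∉ A
    rw [abs_neg]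
  unfold psi
  by_cases h : x ∈ {y : ℝ | |y| ∉ A}
  · rw [Set.indicator_of_mem h, Set.indicator_of_mem (this.2 h)]
  · rw [Set.indicator_of_notMem h, Set.indicator_of_notMem (fun h' => h (this.1 h'))]

lemma psi_eq (X : OA → ℕ → ℕ → ℝ) (A : Set ℝ) (i j : ℕ) :
    (fun ω => psi A (X ω i j)) = (badX X A i j).indicator (1 : OA → ℝ) := by
  rfl

lemma int_psi (μ : Measure OA) {X : OA → ℕ → ℕ → ℝ} (hX : ∀ l l', Measurable fun ω => X ω l l')
    {A : Set ℝ} (hA : MeasurableSet A) (i j : ℕ) :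
    ∫ ω, psi A (X ω i j) ∂μ = μ.real (badX X A i j) := by
  rw [psi_eq, integral_indicator_one (meas_bad hX hA i j)]

lemma int_f_psi (μ : Measure OA) {X : OA → ℕ → ℕ → ℝ} (hX : ∀ l l', Measurable fun ω => X ω l l')
    {A : Set ℝ} (hA : MeasurableSet A) (i j : ℕ) {S : Set OA} (hS : MeasurableSet S) :
    ∫ ω, S.indicator (1 : OA → ℝ) ω * psi A (X ω i j) ∂μ = μ.real (S ∩ badX X A i j) := by
  rw [← integral_indicator_one (hS.inter (meas_bad hX hA i j))]
  congr 1
  funext ω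
  rw [Set.inter_indicator_one]
  rfl

lemma ind_bdd {α : Type*} (T : Set α) : ∃ C, ∀ v, |T.indicator (1 : α → ℝ) v| ≤ C := by
  refine ⟨1, fun v => ?_⟩
  by_cases h : v ∈ T
  · rw [Set.indicator_of_mem h]; simp
  · rw [Set.indicator_of_notMem h]; simp

lemma gg_event1 {μ : Measure OA} (h : GG1 μ) {A A1 A2 : Set ℝ} (hA : MeasurableSet A)
    (hA1 : MeasurableSet A1) (hA2 : MeasurableSet A2) {n m N : ℕ} (hN : 1 ≤ N) (hn : n ≤ N)
    (hm : m ≤ N) :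
    N * μ.real (Sev A A1 A2 n m ∩ badX R1 A1 0 N) =
        μ.real (Sev A A1 A2 n m) * μ.real (badX R1 A1 0 1)
        + ∑ k ∈ Finset.Ico 1 N, μ.real (Sev A A1 A2 n m ∩ badX R1 A1 0 k) := by
  have h0 := h N hN ((Tev A A1 A2 n m N).indicator 1)
    (measurable_one.indicator (meas_Tev hA hA1 hA2 n m N)) (ind_bdd _) (psi A1) (psi_meas hA1)
    (psi_bdd A1) (psi_even A1)
  have hS := meas_Sev hA hA1 hA2 n m
  simp only [fRep_Tev A A1 A2 hN hn hm, int_f_psi μ measurable_R1 hA1 _ _ hS,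
    int_psi μ measurable_R1 hA1, integral_indicator_one hS] at h0
  have hN' : (N : ℝ) ≠ 0 := by positivity
  rw [h0]
  field_simp

lemma gg_event2 {μ : Measure OA} (h : GG2 μ) {A A1 A2 : Set ℝ} (hA : MeasurableSet A)
    (hA1 : MeasurableSet A1) (hA2 : MeasurableSet A2) {n m N : ℕ} (hN : 1 ≤ N) (hn : n ≤ N)
    (hm : m ≤ N) :
    N * μ.real (Sev A A1 A2 n m ∩ badX R2 A2 0 N) =
        μ.real (Sev A A1 A2 n m) * μ.real (badX R2 A2 0 1)
        + ∑ k ∈ Finset.Ico 1 N, μ.real (Sev A A1 A2 n m ∩ badX R2 A2 0 k) := by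
  have h0 := h N hN ((Tev A A1 A2 n m N).indicator 1)
    (measurable_one.indicator (meas_Tev hA hA1 hA2 n m N)) (ind_bdd _) (psi A2) (psi_meas hA2)
    (psi_bdd A2) (psi_even A2)
  have hS := meas_Sev hA hA1 hA2 n m
  simp only [fRep_Tev A A1 A2 hN hn hm, int_f_psi μ measurable_R2 hA2 _ _ hS,
    int_psi μ measurable_R2 hA2, integral_indicator_one hS] at h0
  have hN' : (N : ℝ) ≠ 0 := by positivity
  rw [h0]
  field_simp

lemma meas_perm (π π' : Equiv.Perm ℕ) : Measurable (permMap π π') := by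
  unfold permMap R1 R2 R
  fun_prop

lemma good_perm {X Y : OA → ℕ → ℕ → ℝ} {A : Set ℝ} {n : ℕ} {π : Equiv.Perm ℕ}
    (hπ : ∀ l, π l < n ↔ l < n) {ω ω' : OA} (h : ∀ i j, X ω' i j = Y ω (π i) (π j)) :
    ω' ∈ goodX X A n ↔ ω ∈ goodX Y A n := by
  constructor
  · intro H l l' hl hl' hne
    have := H (π.symm l) (π.symm l') (by rw [← hπ]; simpa using hl) (by rw [← hπ]; simpa using hl')
      (by simpa using hne)
    rw [h] at this
    simpa using this
  · intro H l l' hl hl' hne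
    rw [h]
    exact H _ _ ((hπ l).2 hl) ((hπ l').2 hl') (by simpa using hne)

lemma perm_event {μ : Measure OA} (hs : Setup μ)
    (hc : ∀ᵐ ω ∂μ, ∀ l l', R ω l l' = R ω 0 0) {A A1 A2 : Set ℝ} (hA : MeasurableSet A)
    (hA1 : MeasurableSet A1) (hA2 : MeasurableSet A2) (n m : ℕ) (π π' : Equiv.Perm ℕ)
    (hf : {x | π x ≠ x}.Finite) (hf' : {x | π' x ≠ x}.Finite) (hπ : ∀ l, π l < n ↔ l < n)
    (hπ' : ∀ l, π' l < m ↔ l < m) (V : Set OA) (hV : MeasurableSet V) :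
    μ.real (Sev A A1 A2 n m ∩ permMap π π' ⁻¹' V) = μ.real (Sev A A1 A2 n m ∩ V) := by
  conv_rhs => rw [← hs.exch π π' hf hf']
  rw [map_measureReal_apply (meas_perm π π') ((meas_Sev hA hA1 hA2 n m).inter hV)]
  apply measureReal_congr
  filter_upwards [hc] with ω hω
  apply propext
  change (ω ∈ Sev A A1 A2 n m ∧ _) ↔ (permMap π π' ω ∈ Sev A A1 A2 n m ∧ _)
  refine and_congr (and_congr (and_congr ?_ ?_) ?_) Iff.rfl
  · change R ω 0 0 ∈ A ↔ R ω (π 0) (π' 0) ∈ A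
    rw [hω (π 0) (π' 0)]
  · exact (good_perm hπ (fun i j => rfl)).symm
  · exact (good_perm hπ' (fun i j => rfl)).symm

lemma bad_lt_one {μ : Measure OA} [IsProbabilityMeasure μ] {X : OA → ℕ → ℕ → ℝ}
    (hX : ∀ l l', Measurable fun ω => X ω l l') {A : Set ℝ} (hA : MeasurableSet A)
    (h : 0 < μ {ω | |X ω 0 1| ∈ A}) : μ.real (badX X A 0 1) < 1 := by
  have h1 : badX X A 0 1 = {ω | |X ω 0 1| ∈ A}ᶜ := rfl
  have hm : MeasurableSet {ω | |X ω 0 1| ∈ A} := (measurable_norm.comp (hX 0 1)) hA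
  rw [h1, probReal_compl_eq_one_sub hm]
  have : 0 < μ.real {ω | |X ω 0 1| ∈ A} := ENNReal.toReal_pos h.ne' (measure_ne_top _ _)
  linarith

lemma Sev_pos {μ : Measure OA} (hs : Setup μ) (hGG1 : GG1 μ) (hGG2 : GG2 μ)
    (hc : ∀ᵐ ω ∂μ, ∀ l l', R ω l l' = R ω 0 0) {A A1 A2 : Set ℝ} (hA : MeasurableSet A)
    (hA1 : MeasurableSet A1) (hA2 : MeasurableSet A2) (h0 : 0 < μ (EA A))
    (h1 : 0 < μ {ω | |R1 ω 0 1| ∈ A1}) (h2 : 0 < μ {ω | |R2 ω 0 1| ∈ A2}) (n : ℕ) (hn : 1 ≤ n) :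
    0 < μ.real (Sev A A1 A2 n n) := by
  have := hs.prob
  have hg0 : ∀ (X : OA → ℕ → ℕ → ℝ) (B : Set ℝ), goodX X B 0 = Set.univ := by
    intro X B; ext ω; simp [goodX]
  have e1 : ∀ k, EA A ∩ goodX R1 A1 k = Sev A A1 A2 k 0 := by
    intro k; simp [Sev, hg0]
  have e2 : ∀ k m, EA A ∩ goodX R1 A1 k ∩ goodX R2 A2 m = Sev A A1 A2 k m := fun _ _ => rfl
  have key1 : ∀ k, 1 ≤ k → 0 < μ.real (EA A ∩ goodX R1 A1 k) := by
    refine core μ R1 measurable_R1 ?_ A1 hA1 (EA A) ((measurable_R 0 0) hA) 0 ?_ ?_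
      (ENNReal.toReal_pos h0.ne' (measure_ne_top _ _)) (bad_lt_one measurable_R1 hA1 h1)
    · filter_upwards [hs.symm] with ω h l l' using (h l l').1
    · intro k N hk hkN _
      simp only [e1]
      exact gg_event1 hGG1 hA hA1 hA2 (hk.trans hkN) hkN (Nat.zero_le _)
    · intro k π hf hπ i j
      simp only [e1]
      exact perm_event hs hc hA hA1 hA2 k 0 π (Equiv.refl ℕ) hf (by simp) hπ (by simp)
        (badX R1 A1 i j) (meas_bad measurable_R1 hA1 i j)
  have key2 : ∀ m, 1 ≤ m → 0 < μ.real (EA A ∩ goodX R1 A1 n ∩ goodX R2 A2 m) := by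
    refine core μ R2 measurable_R2 ?_ A2 hA2 (EA A ∩ goodX R1 A1 n)
      (((measurable_R 0 0) hA).inter (meas_good measurable_R1 hA1 n)) n ?_ ?_
      (key1 n hn) (bad_lt_one measurable_R2 hA2 h2)
    · filter_upwards [hs.symm] with ω h l l' using (h l l').2
    · intro k N hk hkN hnN
      simp only [e2]
      exact gg_event2 hGG2 hA hA1 hA2 (hk.trans hkN) hnN hkN
    · intro k π hf hπ i j
      simp only [e2]
      exact perm_event hs hc hA hA1 hA2 n k (Equiv.refl ℕ) π (by simp) hf (by simp) hπ
        (badX R2 A2 i j) (meas_bad measurable_R2 hA2 i j)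
  exact key2 n hn

lemma sum_le_aux {X : ℕ → ℕ → ℝ} {n : ℕ} {s e : ℝ} (hs : 0 ≤ s) (hn : 1 ≤ n * e)
    (hd : ∀ l, X l l = 1) (hg : ∀ l l', l < n → l' < n → l ≠ l' → |X l l'| < s) :
    ∑ i : Fin n, ∑ j : Fin n, X i j ≤ n * n * (s + e) := by
  have h1 : ∀ i : Fin n, ∑ j : Fin n, X i j ≤ n * s + 1 := by
    intro i
    have : ∀ j : Fin n, X i j ≤ s + if i = j then 1 else 0 := by
      intro j
      split_ifs with h
      · subst h; rw [hd]; linarith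
      · have := hg i j i.2 j.2 (fun h' => h (Fin.ext h'))
        linarith [le_abs_self (X i j)]
    refine (Finset.sum_le_sum fun j _ => this j).trans ?_
    simp [Finset.sum_add_distrib]
  refine (Finset.sum_le_sum fun i _ => h1 i).trans ?_
  simp only [Finset.sum_const, Finset.card_univ, Fintype.card_fin, nsmul_eq_mul]
  have : (n : ℝ) * 1 ≤ n * (n * e) := by gcongr
  nlinarith

lemma quad_aux {ω : OA} {n : ℕ} (hn : 1 ≤ n) {u v r : ℝ} (hv : 0 < v)
    (hpsd : (ovMatrix ω n).PosSemidef) (hr : ∀ l l', R ω l l' = r)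
    (hu1 : ∑ i : Fin n, ∑ j : Fin n, R1 ω i j ≤ n * n * u)
    (hv1 : ∑ i : Fin n, ∑ j : Fin n, R2 ω i j ≤ n * n * v) : r ^ 2 ≤ u * v := by
  have h := hpsd.dotProduct_mulVec_nonneg (Sum.elim (fun _ => v) (fun _ => -r))
  have e : star (Sum.elim (fun _ : Fin n => v) (fun _ : Fin n => -r)) ⬝ᵥ
      (ovMatrix ω n).mulVec (Sum.elim (fun _ => v) (fun _ => -r))
      = v ^ 2 * ∑ i : Fin n, ∑ j : Fin n, R1 ω i j + r ^ 2 * ∑ i : Fin n, ∑ j : Fin n, R2 ω i j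
        - 2 * (n * n) * v * r ^ 2 := by
    simp only [dotProduct, Matrix.mulVec, Fintype.sum_sum_type, Sum.elim_inl, Sum.elim_inr,
      ovMatrix, hr, Pi.star_apply, star_trivial, ← Finset.sum_mul, Finset.sum_const,
      Finset.card_univ, Fintype.card_fin, nsmul_eq_mul, ← Finset.mul_sum,
      Finset.sum_add_distrib]
    ring
  rw [e] at h
  have hn' : (1 : ℝ) ≤ n := by exact_mod_cast hn
  have h1 : v ^ 2 * ∑ i : Fin n, ∑ j : Fin n, R1 ω i j ≤ v ^ 2 * (n * n * u) := by gcongr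
  have h2 : r ^ 2 * ∑ i : Fin n, ∑ j : Fin n, R2 ω i j ≤ r ^ 2 * (n * n * v) := by gcongr
  have h3 : 0 ≤ (n * n * v) * (u * v - r ^ 2) := by nlinarith
  have h4 : (0 : ℝ) < n * n * v := by positivity
  have := nonneg_of_mul_nonneg_right h3 h4
  linarith

/-- The support of the law of `|X_{0,1}|`. -/
def suppX (X : OA → ℕ → ℕ → ℝ) (μ : Measure OA) : Set ℝ :=
  {x | ∀ U : Set ℝ, IsOpen U → x ∈ U → 0 < μ {ω | |X ω 0 1| ∈ U}}

lemma suppX_nonneg (X : OA → ℕ → ℕ → ℝ) (μ : Measure OA) : 0 ≤ sInf (suppX X μ) := by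
  apply Real.sInf_nonneg
  intro x hx
  by_contra h
  push Not at h
  have := hx (Set.Iio 0) isOpen_Iio h
  have e : {ω | |X ω 0 1| ∈ Set.Iio (0 : ℝ)} = ∅ := by
    ext ω; simp
  rw [e] at this
  simp at this

lemma suppX_pos {X : OA → ℕ → ℕ → ℝ} (hX : ∀ l l', Measurable fun ω => X ω l l')
    (μ : Measure OA) [IsProbabilityMeasure μ] {ε : ℝ} (hε : 0 < ε) :
    0 < μ {ω | |X ω 0 1| ∈ Set.Iio (sInf (suppX X μ) + ε)} := by
  have hm : Measurable fun ω => |X ω 0 1| := measurable_norm.comp (hX 0 1)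
  have hne : (suppX X μ).Nonempty := by
    have : IsProbabilityMeasure (μ.map fun ω => |X ω 0 1|) :=
      Measure.isProbabilityMeasure_map hm.aemeasurable
    obtain ⟨x, hx⟩ := Measure.nonempty_support (μ := μ.map fun ω => |X ω 0 1|)
      (IsProbabilityMeasure.ne_zero _)
    refine ⟨x, fun U hU hxU => ?_⟩
    have := (Measure.mem_support_iff_forall x).1 hx U (hU.mem_nhds hxU)
    rwa [Measure.map_apply hm hU.measurableSet] at this
  obtain ⟨a, ha, hlt⟩ := exists_lt_of_csInf_lt hne (lt_add_of_pos_right (sInf (suppX X μ)) hε)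
  exact ha _ isOpen_Iio hlt

end OverlapArray

/-- In the overlap array setup, suppose `μ` satisfies the
Ghirlanda–Guerra identities for both systems, is a.s. positive semidefinite, and
`μ(R_{l,l'} = R_{1,1} for all l,l') = 1`. With `c₁ = inf supp μ₁` and `c₂ = inf supp μ₂`,
one has `μ(|R_{1,1}| > √(c₁ c₂)) = 0`. -/
theorem statement_19 (μ : MeasureTheory.Measure OA) (hsetup : Setup μ)
    (hGG1 : GG1 μ) (hGG2 : GG2 μ) (hpsd : PSDas μ)
    (hconc : μ {ω | ∀ l l', R ω l l' = R ω 0 0} = 1) :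
    μ {ω | Real.sqrt (sInf (supp1 μ) * sInf (supp2 μ)) < |R ω 0 0|} = 0 := by
  have := hsetup.prob
  have hms : MeasurableSet {ω : OA | ∀ l l', R ω l l' = R ω 0 0} := by
    simp only [Set.ofPred_forall]
    exact MeasurableSet.iInter fun l => MeasurableSet.iInter fun l' =>
      measurableSet_eq_fun (measurable_R l l') (measurable_R 0 0)
  have hc : ∀ᵐ ω ∂μ, ∀ l l', R ω l l' = R ω 0 0 := (prob_compl_eq_zero_iff hms).2 hconc
  have hc1 : 0 ≤ sInf (supp1 μ) := suppX_nonneg R1 μ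
  have hc2 : 0 ≤ sInf (supp2 μ) := suppX_nonneg R2 μ
  have p1 : ∀ ε : ℝ, 0 < ε → 0 < μ {ω | |R1 ω 0 1| ∈ Set.Iio (sInf (supp1 μ) + ε)} :=
    fun ε hε => suppX_pos measurable_R1 μ hε
  have p2 : ∀ ε : ℝ, 0 < ε → 0 < μ {ω | |R2 ω 0 1| ∈ Set.Iio (sInf (supp2 μ) + ε)} :=
    fun ε hε => suppX_pos measurable_R2 μ hε
  generalize sInf (supp1 μ) = c1 at *
  generalize sInf (supp2 μ) = c2 at *
  have main : ∀ ε : ℝ, 0 < ε →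
      μ (EA {x | (c1 + ε + ε) * (c2 + ε + ε) < x ^ 2}) = 0 := by
    intro ε hε
    by_contra hne
    have hA : MeasurableSet {x : ℝ | (c1 + ε + ε) * (c2 + ε + ε) < x ^ 2} :=
      measurableSet_lt measurable_const (by fun_prop)
    obtain ⟨n, hn⟩ := exists_nat_gt (1 / ε)
    have hne1 : 1 ≤ (n : ℝ) * ε := by
      rw [div_lt_iff₀ hε] at hn; exact hn.le
    have hn1 : 1 ≤ n := by
      rcases Nat.eq_zero_or_pos n with rfl | h
      · norm_num at hne1
      · exact h
    have hpos := Sev_pos hsetup hGG1 hGG2 hc hA measurableSet_Iio measurableSet_Iio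
      (pos_iff_ne_zero.2 hne) (p1 ε hε) (p2 ε hε) n hn1
    have hz : μ (Sev {x : ℝ | (c1 + ε + ε) * (c2 + ε + ε) < x ^ 2} (Set.Iio (c1 + ε))
        (Set.Iio (c2 + ε)) n n) = 0 := by
      rw [measure_eq_zero_iff_ae_notMem]
      filter_upwards [hc, hsetup.diag, hpsd] with ω hω hd hps hmem
      obtain ⟨⟨h0, h1⟩, h2⟩ := hmem
      have s1 := sum_le_aux (X := R1 ω) (by linarith) hne1 (fun l => (hd l).1) h1
      have s2 := sum_le_aux (X := R2 ω) (by linarith) hne1 (fun l => (hd l).2) h2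
      have := quad_aux hn1 (by linarith) (hps n hn1) hω s1 s2
      exact absurd h0 (not_lt.2 this)
    rw [measureReal_def, hz] at hpos
    simp at hpos
  refine measure_mono_null (t := ⋃ k : ℕ, EA {x | (c1 + 1 / ((k : ℝ) + 1) + 1 / ((k : ℝ) + 1)) *
    (c2 + 1 / ((k : ℝ) + 1) + 1 / ((k : ℝ) + 1)) < x ^ 2}) ?_
    (measure_iUnion_null fun k => main _ (by positivity))
  intro ω hω
  have hlt : c1 * c2 < R ω 0 0 ^ 2 := by
    have := Real.lt_sq_of_sqrt_lt (Set.mem_ofPred_eq ▸ hω)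
    rwa [sq_abs] at this
  have ht : Filter.Tendsto (fun k : ℕ => (c1 + 1 / ((k : ℝ) + 1) + 1 / ((k : ℝ) + 1)) *
    (c2 + 1 / ((k : ℝ) + 1) + 1 / ((k : ℝ) + 1))) Filter.atTop (nhds ((c1 + 0 + 0) * (c2 + 0 + 0))) := by
    have h := tendsto_one_div_add_atTop_nhds_zero_nat (𝕜 := ℝ)
    exact ((h.const_add c1).add h).mul ((h.const_add c2).add h)
  simp only [add_zero] at ht
  obtain ⟨k, hk⟩ := (ht.eventually_lt_const hlt).exists
  exact Set.mem_iUnion.2 ⟨k, hk⟩
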